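/- Let (X, d, μ) be a metric measure space whose measure is Ahlfors ν-regular with constants 0 < c₁ ≤ c₂ < ∞ satisfying 2^{1−ν}·(c₂/c₁) < 1, and let K be a kernel satisfying the size condition and the pseudo-radial null condition. Let f : X → ℝ be locally integrable and let g : X → [0,∞] be locally integrable such that the pair (f, g) satisfies a weak (1, ρ')-Poincaré–Sobolev inequality for some 1 < ρ' < ν. Suppose g ∈ L^1(μ) and g belongs to the Morrey space M^{p,q}_μ(X) for some 1 < p ≤ q < ∞ with q/ν < 1, and set r = ν/(ν − q), so that (1 − q/ν)·r = 1. Then there is a constant C such that the weak-type inequality sup_{α>0} α · μ({x ∈ X : T*_K f(x) > α})^{1/r} ≤ C · ‖g‖_{L^1(μ)}^{1 − q/ν} · ‖g‖_{M^{p,q}}^{q/ν} holds. -/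

import Mathlib

open MeasureTheory Metric ENNReal

variable {X : Type*} [MetricSpace X] [MeasurableSpace X] [BorelSpace X]

/-- Riesz-type potential `R_{s,μ} g (x) = ∫ d(x,y)^s / μ(B(x,d(x,y))) · g(y) dμ(y)`,
for `g : X → [0,∞]`, valued in `[0,∞]`. -/
noncomputable def rieszPot (μ : Measure X) (s : ℝ) (g : X → ℝ≥0∞) (x : X) : ℝ≥0∞ :=
  ∫⁻ y, (ENNReal.ofReal (dist x y ^ s) / μ (ball x (dist x y))) * g y ∂μ

/-- Riesz-type potential applied to a real (signed) function, as a Bochner integral. -/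
noncomputable def rieszR (μ : Measure X) (s : ℝ) (f : X → ℝ) (x : X) : ℝ :=
  ∫ y, (dist x y ^ s / (μ (ball x (dist x y))).toReal) * f y ∂μ

/-- Hardy–Littlewood maximal function: sup over open balls containing `x`. -/
noncomputable def maximalFn (μ : Measure X) (g : X → ℝ≥0∞) (x : X) : ℝ≥0∞ :=
  ⨆ (z : X) (r : ℝ) (_ : 0 < r) (_ : x ∈ ball z r),
    (μ (ball z r))⁻¹ * ∫⁻ y in ball z r, g y ∂μ

/-- Morrey norm `‖g‖_{M^{p,q}}`, valued in `[0,∞]`. -/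
noncomputable def morreyNorm (μ : Measure X) (p q : ℝ) (g : X → ℝ≥0∞) : ℝ≥0∞ :=
  ⨆ (z : X) (r : ℝ) (_ : 0 < r),
    (μ (ball z r) ^ (p / q - 1) * ∫⁻ y in ball z r, g y ^ p ∂μ) ^ (1 / p)

/-- Truncated singular integral `T^ε_K f (x)`. -/
noncomputable def truncT (μ : Measure X) (K : X → X → ℝ) (f : X → ℝ) (ε : ℝ) (x : X) : ℝ :=
  ∫ y in {y | ε < dist x y}, K x y * f y ∂μ

/-- Maximal singular operator `T^*_K f (x) = sup_{ε>0} |T^ε_K f (x)|`, valued in `[0,∞]`. -/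
noncomputable def maxT (μ : Measure X) (K : X → X → ℝ) (f : X → ℝ) (x : X) : ℝ≥0∞ :=
  ⨆ (ε : ℝ) (_ : 0 < ε), ENNReal.ofReal |truncT μ K f ε x|

/-- Ahlfors `ν`-regularity: `c₁ r^ν ≤ μ(B(x,r)) ≤ c₂ r^ν`. -/
def IsAhlfors (μ : Measure X) (c₁ c₂ ν : ℝ) : Prop :=
  ∀ (x : X) (r : ℝ), 0 < r →
    ENNReal.ofReal (c₁ * r ^ ν) ≤ μ (ball x r) ∧ μ (ball x r) ≤ ENNReal.ofReal (c₂ * r ^ ν)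

/-- Size condition on the kernel: `|K(x,y)| ≤ C_K / d(x,y)^ν` for `x ≠ y`. -/
def SizeCond (K : X → X → ℝ) (CK ν : ℝ) : Prop :=
  ∀ x y : X, x ≠ y → |K x y| ≤ CK / dist x y ^ ν

/-- Pseudo-radial null condition: `∫_{a < d(x,y) < b} K(x,y) dμ(y) = 0`. -/
def NullCond (μ : Measure X) (K : X → X → ℝ) : Prop :=
  ∀ (x : X) (a b : ℝ), 0 < a → a < b →
    ∫ y in {y | a < dist x y ∧ dist x y < b}, K x y ∂μ = 0

/-- Weak `(1,ρ')`-Poincaré–Sobolev inequality for the pair `(f,g)` with constants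
`C_P > 0` and dilation `σ`. -/
def PoincareSobolev (μ : Measure X) (f : X → ℝ) (g : X → ℝ≥0∞) (ρ' CP σ : ℝ) : Prop :=
  ∀ (x : X) (r : ℝ), 0 < r →
    ((μ (ball x r))⁻¹ *
        ∫⁻ y in ball x r, ENNReal.ofReal (|f y - ⨍ z in ball x r, f z ∂μ| ^ ρ') ∂μ) ^ (1 / ρ')
      ≤ ENNReal.ofReal (CP * r) *
        ((μ (ball x (σ * r)))⁻¹ * ∫⁻ y in ball x (σ * r), g y ∂μ)

/-- Local integrability for an `[0,∞]`-valued function: measurable with finite integral on balls. -/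
def LocIntE (μ : Measure X) (g : X → ℝ≥0∞) : Prop :=
  Measurable g ∧ ∀ (z : X) (r : ℝ), ∫⁻ y in ball z r, g y ∂μ < ∞

/-- `L^r` norm (in `[0,∞]`) of an `[0,∞]`-valued function. -/
noncomputable def lpNormE (μ : Measure X) (r : ℝ) (h : X → ℝ≥0∞) : ℝ≥0∞ :=
  (∫⁻ x, h x ^ r ∂μ) ^ (1 / r)

/-- Lorentz `L^{r,m}` quasinorm (in `[0,∞]`) of an `[0,∞]`-valued function. -/
noncomputable def lorentzNormE (μ : Measure X) (r m : ℝ) (h : X → ℝ≥0∞) : ℝ≥0∞ :=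
  ENNReal.ofReal (r ^ (1 / m)) *
    (∫⁻ α in Set.Ioi (0 : ℝ),
        (ENNReal.ofReal α * μ {x | ENNReal.ofReal α < h x} ^ (1 / r)) ^ m *
          ENNReal.ofReal α⁻¹) ^ (1 / m)


section AhlforsRegular

variable {μ : Measure X} {c₁ c₂ ν : ℝ}

lemma IsAhlfors.measure_ball_pos (hA : IsAhlfors μ c₁ c₂ ν) (hc₁ : 0 < c₁) (x : X) {r : ℝ}
    (hr : 0 < r) : 0 < μ (ball x r) :=
  lt_of_lt_of_le (ENNReal.ofReal_pos.2 (by positivity)) (hA x r hr).1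

lemma IsAhlfors.measure_ball_lt_top (hA : IsAhlfors μ c₁ c₂ ν) (x : X) {r : ℝ}
    (hr : 0 < r) : μ (ball x r) < ∞ :=
  (hA x r hr).2.trans_lt ENNReal.ofReal_lt_top

lemma IsAhlfors.sigmaFinite (hA : IsAhlfors μ c₁ c₂ ν) : SigmaFinite μ := by
  rcases isEmpty_or_nonempty X with h | ⟨⟨x₀⟩⟩
  · have : μ = 0 := μ.eq_zero_of_isEmpty
    rw [this]; infer_instance
  · refine ⟨⟨⟨fun n : ℕ => ball x₀ (n + 1), fun _ => trivial,
      fun n => hA.measure_ball_lt_top x₀ (by positivity), ?_⟩⟩⟩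
    refine Set.eq_univ_of_forall fun x => Set.mem_iUnion.2 ?_
    obtain ⟨n, hn⟩ := exists_nat_gt (dist x x₀)
    exact ⟨n, by rw [mem_ball]; linarith⟩

lemma IsAhlfors.secondCountableTopology (hA : IsAhlfors μ c₁ c₂ ν) (hc₁ : 0 < c₁) :
    SecondCountableTopology X := by
  have := hA.sigmaFinite
  refine Metric.secondCountable_of_almost_dense_set fun ε hε => ?_
  obtain ⟨u, -, hdisj, hcov⟩ := Vitali.exists_disjoint_subfamily_covering_enlargement_closedBall
    (Set.univ : Set X) id (fun _ => ε / 5) (ε / 5) (fun _ _ => le_rfl) 5 (by norm_num)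
  refine ⟨u, ?_, fun x => ?_⟩
  · have h := Measure.countable_meas_pos_of_disjoint_iUnion (μ := μ)
      (As := fun a : u => closedBall (a : X) (ε / 5)) (fun _ => isClosed_closedBall.measurableSet)
      (fun a b hab => hdisj a.2 b.2 (fun h => hab (Subtype.ext h)))
    have huniv : {i : u | 0 < μ (closedBall (i : X) (ε / 5))} = Set.univ :=
      Set.eq_univ_of_forall fun i => (hA.measure_ball_pos hc₁ (i : X) (by positivity)).trans_le
        (measure_mono ball_subset_closedBall)
    rw [huniv, Set.countable_univ_iff] at h
    exact h
  · obtain ⟨b, hb, hsub⟩ := hcov x trivial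
    refine ⟨b, hb, ?_⟩
    have := hsub (mem_closedBall_self (by positivity : (0 : ℝ) ≤ ε / 5))
    simp only [id, mem_closedBall] at this
    linarith

/-- Weak `(1,1)` bound for the centred maximal function, phrased as the measure of
the set of centres of balls with large `g`-mass. -/
lemma IsAhlfors.measure_large_mass_le (hA : IsAhlfors μ c₁ c₂ ν) (hc₁ : 0 < c₁) (hν : 0 < ν)
    {g : X → ℝ≥0∞} (hg : ∫⁻ x, g x ∂μ < ∞) {l : ℝ} (hl : 0 < l) :
    μ {x | ∃ r, 0 < r ∧ ENNReal.ofReal (l * r ^ ν) < ∫⁻ y in ball x r, g y ∂μ} ≤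
      ENNReal.ofReal (c₂ * 6 ^ ν / l) * ∫⁻ x, g x ∂μ := by
  have := hA.secondCountableTopology hc₁
  set t : Set (X × ℝ) :=
    {z | 0 < z.2 ∧ ENNReal.ofReal (l * z.2 ^ ν) < ∫⁻ y in ball z.1 z.2, g y ∂μ} with ht
  have hR : ∀ a ∈ t, a.2 ≤ ((∫⁻ x, g x ∂μ).toReal / l) ^ (1 / ν) := by
    rintro ⟨x, r⟩ ⟨hr, h⟩
    dsimp only at hr h ⊢
    have h1 := (h.trans_le (setLIntegral_le_lintegral _ _)).le
    rw [ENNReal.ofReal_le_iff_le_toReal hg.ne] at h1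
    rwa [← Real.rpow_le_rpow_iff hr.le (by positivity) hν, ← Real.rpow_mul (by positivity),
      one_div_mul_cancel hν.ne', Real.rpow_one, le_div_iff₀' hl]
  obtain ⟨u, hut, hdisj, hcov⟩ :=
    Vitali.exists_disjoint_subfamily_covering_enlargement_closedBall t Prod.fst Prod.snd _ hR 5
      (by norm_num)
  have hu : u.Countable := hdisj.countable_of_nonempty_interior fun a ha =>
    ⟨a.1, ball_subset_interior_closedBall (mem_ball_self (hut ha).1)⟩
  calc μ {x | ∃ r, 0 < r ∧ ENNReal.ofReal (l * r ^ ν) < ∫⁻ y in ball x r, g y ∂μ}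
      ≤ μ (⋃ a ∈ u, ball a.1 (6 * a.2)) := by
        refine measure_mono ?_
        rintro x ⟨r, hr, h⟩
        obtain ⟨b, hb, hsub⟩ := hcov (x, r) ⟨hr, h⟩
        refine Set.mem_biUnion hb ?_
        have h1 := hsub (mem_closedBall_self hr.le)
        have h2 := (hut hb).1
        rw [mem_closedBall] at h1
        rw [mem_ball]
        linarith
    _ ≤ ∑' a : u, μ (ball a.1.1 (6 * a.1.2)) := measure_biUnion_le _ hu _
    _ ≤ ∑' a : u, ENNReal.ofReal (c₂ * 6 ^ ν / l) * ∫⁻ y in closedBall a.1.1 a.1.2, g y ∂μ := by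
        refine ENNReal.tsum_le_tsum fun a => ?_
        obtain ⟨h1, h2⟩ := hut a.2
        have hc₂ : 0 < c₂ := by
          have := (hA.measure_ball_pos hc₁ a.1.1 zero_lt_one).trans_le (hA a.1.1 1 one_pos).2
          simpa using this
        refine (hA _ _ (by positivity)).2.trans ?_
        calc ENNReal.ofReal (c₂ * (6 * a.1.2) ^ ν)
            = ENNReal.ofReal (c₂ * 6 ^ ν / l) * ENNReal.ofReal (l * a.1.2 ^ ν) := by
              rw [← ENNReal.ofReal_mul (by positivity), Real.mul_rpow (by norm_num) h1.le]
              congr 1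
              field_simp
          _ ≤ _ := by
              gcongr
              exact h2.le.trans (lintegral_mono_set ball_subset_closedBall)
    _ = ENNReal.ofReal (c₂ * 6 ^ ν / l) * ∫⁻ y in ⋃ a ∈ u, closedBall a.1 a.2, g y ∂μ := by
        rw [ENNReal.tsum_mul_left, lintegral_biUnion hu
          (fun _ _ => isClosed_closedBall.measurableSet) hdisj]
    _ ≤ _ := mul_le_mul_right (setLIntegral_le_lintegral _ _) _

end AhlforsRegular

/-- Hölder's inequality against the constant function `1`. -/
lemma lintegral_le_rpow_lintegral_rpow_mul {α : Type*} [MeasurableSpace α] (μ : Measure α)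
    {h : α → ℝ≥0∞} (hh : AEMeasurable h μ) {p : ℝ} (hp : 1 < p) :
    ∫⁻ y, h y ∂μ ≤ (∫⁻ y, h y ^ p ∂μ) ^ (1 / p) * μ Set.univ ^ (1 - 1 / p) := by
  have hpq := Real.HolderConjugate.conjExponent hp
  have := ENNReal.lintegral_mul_le_Lp_mul_Lq μ hpq hh (aemeasurable_const (b := (1 : ℝ≥0∞)))
  have he : 1 / p.conjExponent = 1 - 1 / p := by
    simp only [one_div]; exact hpq.one_sub_inv.symm
  simpa [he] using this

/-- Dyadic sums of `min (t, t⁻ˢ)` are bounded uniformly in the starting scale. -/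
lemma sum_min_dyadic_le {s : ℝ} (hs : 0 < s) (n : ℕ) {t : ℝ} (ht : 0 < t) :
    ∑ k ∈ Finset.range n, min (t * 2 ^ k) ((t * 2 ^ k) ^ (-s)) ≤ (1 - (2 : ℝ) ^ (-s))⁻¹ + 2 := by
  set c := (1 - (2 : ℝ) ^ (-s))⁻¹ with hc
  have h21 : (2 : ℝ) ^ (-s) < 1 := Real.rpow_lt_one_of_one_lt_of_neg (by norm_num) (by linarith)
  have h20 : (0 : ℝ) < (2 : ℝ) ^ (-s) := by positivity
  have hlarge : ∀ (n : ℕ) (t : ℝ), 1 ≤ t →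
      ∑ k ∈ Finset.range n, min (t * 2 ^ k) ((t * 2 ^ k) ^ (-s)) ≤ c := by
    intro n t ht
    calc ∑ k ∈ Finset.range n, min (t * 2 ^ k) ((t * 2 ^ k) ^ (-s))
        ≤ ∑ k ∈ Finset.range n, ((2 : ℝ) ^ (-s)) ^ k := by
          refine Finset.sum_le_sum fun k _ => (min_le_right _ _).trans ?_
          rw [Real.mul_rpow (by positivity) (by positivity), ← Real.rpow_natCast_mul (by norm_num),
            mul_comm (k : ℝ), Real.rpow_mul_natCast (by norm_num)]
          exact mul_le_of_le_one_left (by positivity)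
            (Real.rpow_le_one_of_one_le_of_nonpos ht (by linarith))
      _ ≤ ∑' k : ℕ, ((2 : ℝ) ^ (-s)) ^ k :=
          (summable_geometric_of_lt_one h20.le h21).sum_le_tsum _ (fun _ _ => by positivity)
      _ = c := tsum_geometric_of_lt_one h20.le h21
  have hc0 : 0 < c := inv_pos.2 (by linarith)
  have hsmall : ∀ (n : ℕ) (t : ℝ), 0 < t → t ≤ 2 →
      ∑ k ∈ Finset.range n, min (t * 2 ^ k) ((t * 2 ^ k) ^ (-s)) ≤ c + 2 - t := by
    intro n
    induction n with
    | zero => intro t _ ht; simp; linarith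
    | succ n ih =>
      intro t ht0 ht
      rcases le_or_gt 1 t with h | h
      · linarith [hlarge (n + 1) t h]
      · rw [Finset.sum_range_succ']
        have h1 := ih (2 * t) (by linarith) (by linarith)
        have h2 : min (t * 2 ^ 0) ((t * 2 ^ 0) ^ (-s)) ≤ t := (min_le_left _ _).trans (by simp)
        have h3 : ∀ k : ℕ, t * 2 ^ (k + 1) = 2 * t * 2 ^ k := fun k => by ring
        simp only [h3]
        linarith
  rcases le_or_gt t 2 with h | h
  · linarith [hsmall n t ht h]
  · linarith [hlarge n t (by linarith)]

/-- Interpolated form of `sum_min_dyadic_le`. -/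
lemma sum_min_dyadic_interp_le {s a b ε : ℝ} (hs : 0 < s) (ha : 0 < a) (hb : 0 < b) (hε : 0 < ε)
    (n : ℕ) :
    ∑ k ∈ Finset.range n, min (a * (2 ^ k * ε)) (b * (2 ^ k * ε) ^ (-s)) ≤
      ((1 - (2 : ℝ) ^ (-s))⁻¹ + 2) * (a ^ (s / (1 + s)) * b ^ (1 / (1 + s))) := by
  set δ := (b / a) ^ (1 / (1 + s)) with hδ
  have hδ0 : 0 < δ := by positivity
  have hδs : δ ^ (1 + s) = b / a := by
    rw [hδ, ← Real.rpow_mul (by positivity), one_div_mul_cancel (by linarith), Real.rpow_one]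
  have h1 : a * δ = a ^ (s / (1 + s)) * b ^ (1 / (1 + s)) := by
    rw [hδ, Real.div_rpow hb.le ha.le,
      show s / (1 + s) = 1 - 1 / (1 + s) by field_simp; ring, Real.rpow_sub ha, Real.rpow_one]
    ring
  have h2 : b * δ ^ (-s) = a * δ := by
    have : δ ^ (1 + s) = δ * δ ^ s := by rw [Real.rpow_add hδ0, Real.rpow_one]
    rw [this] at hδs
    rw [Real.rpow_neg hδ0.le]
    field_simp at hδs ⊢
    linarith
  rw [← h1, mul_comm]
  refine le_trans (le_of_eq ?_)
    (mul_le_mul_of_nonneg_left (sum_min_dyadic_le hs n (t := ε / δ) (by positivity))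
      (by positivity : 0 ≤ a * δ))
  rw [Finset.mul_sum]
  refine Finset.sum_congr rfl fun k _ => ?_
  rw [mul_min_of_nonneg _ _ (by positivity : 0 ≤ a * δ)]
  congr 1
  · field_simp
  · rw [show ε / δ * 2 ^ k = (2 ^ k * ε) / δ by ring, Real.div_rpow (by positivity) hδ0.le, ← h2]
    field_simp

section Kernel

variable {μ : Measure X} {c₁ c₂ ν CK CP σ ρ' : ℝ} {K : X → X → ℝ} {f : X → ℝ} {g : X → ℝ≥0∞}

lemma measurableSet_annulus (x : X) (a b : ℝ) : MeasurableSet {y | a < dist x y ∧ dist x y ≤ b} :=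
  (continuous_const.dist continuous_id).measurable measurableSet_Ioc

lemma measurableSet_open_annulus (x : X) (a b : ℝ) :
    MeasurableSet {y | a < dist x y ∧ dist x y < b} :=
  (continuous_const.dist continuous_id).measurable measurableSet_Ioo

lemma SizeCond.enorm_le (hsize : SizeCond K CK ν) (hν : 0 < ν) (hCK : 0 < CK) {x y : X} {a : ℝ}
    (ha : 0 < a) (hy : a < dist x y) : ‖K x y‖ₑ ≤ ENNReal.ofReal (CK / a ^ ν) := by
  have hxy : x ≠ y := dist_pos.1 (ha.trans hy)
  rw [Real.enorm_eq_ofReal_abs]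
  refine ENNReal.ofReal_le_ofReal ((hsize x y hxy).trans ?_)
  gcongr

lemma SizeCond.integrableOn (hsize : SizeCond K CK ν) (hA : IsAhlfors μ c₁ c₂ ν) (hν : 0 < ν)
    (hCK : 0 < CK) (hK : Measurable (Function.uncurry K)) (x : X) {a b : ℝ} (ha : 0 < a) :
    IntegrableOn (K x) {y | a < dist x y ∧ dist x y < b} μ := by
  have hm : MeasurableSet {y | a < dist x y ∧ dist x y < b} :=
    measurableSet_open_annulus x a b
  rcases le_or_gt b 0 with hb | hb
  · have : {y | a < dist x y ∧ dist x y < b} = ∅ :=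
      Set.eq_empty_of_forall_notMem fun y hy => by linarith [hy.1, hy.2]
    rw [this]; exact integrableOn_empty
  · refine ⟨hK.of_uncurry_left.aestronglyMeasurable, ?_⟩
    calc ∫⁻ y in {y | a < dist x y ∧ dist x y < b}, ‖K x y‖ₑ ∂μ
        ≤ ∫⁻ _ in {y | a < dist x y ∧ dist x y < b}, ENNReal.ofReal (CK / a ^ ν) ∂μ :=
          setLIntegral_mono' hm fun y hy => hsize.enorm_le hν hCK ha hy.1
      _ = ENNReal.ofReal (CK / a ^ ν) * μ {y | a < dist x y ∧ dist x y < b} :=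
          setLIntegral_const _ _
      _ < ∞ := by
          refine ENNReal.mul_lt_top ENNReal.ofReal_lt_top
            ((measure_mono fun y hy => ?_).trans_lt (hA.measure_ball_lt_top x hb))
          rw [mem_ball']; exact hy.2

/-- The null condition extends to annuli containing their outer sphere. -/
lemma NullCond.integral_annulus (hnull : NullCond μ K) (hsize : SizeCond K CK ν)
    (hA : IsAhlfors μ c₁ c₂ ν) (hν : 0 < ν) (hCK : 0 < CK) (hK : Measurable (Function.uncurry K))
    (x : X) {a b : ℝ} (ha : 0 < a) (hab : a < b) :
    ∫ y in {y | a < dist x y ∧ dist x y ≤ b}, K x y ∂μ = 0 := by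
  set s : ℕ → Set X := fun n => {y | a < dist x y ∧ dist x y < b + 1 / ((n : ℝ) + 1)} with hs
  have hint : ⋂ n, s n = {y | a < dist x y ∧ dist x y ≤ b} := by
    ext y
    simp only [hs, Set.mem_iInter, Set.mem_ofPred_eq]
    constructor
    · refine fun h => ⟨(h 0).1, le_of_forall_pos_lt_add fun e he => ?_⟩
      obtain ⟨n, hn⟩ := exists_nat_one_div_lt he
      linarith [(h n).2]
    · exact fun h n => ⟨h.1, h.2.trans_lt (by linarith [Nat.one_div_pos_of_nat (α := ℝ) (n := n)])⟩
  have hlim := tendsto_setIntegral_of_antitone (μ := μ) (f := K x) (s := s)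
    (fun n => measurableSet_open_annulus x a _)
    (fun m n hmn y hy => ⟨hy.1, hy.2.trans_le (by gcongr)⟩)
    ⟨0, hsize.integrableOn hA hν hCK hK x ha⟩
  rw [hint] at hlim
  have hzero : ∀ n, ∫ y in s n, K x y ∂μ = 0 := fun n =>
    hnull x a _ ha (hab.trans (by linarith [Nat.one_div_pos_of_nat (α := ℝ) (n := n)]))
  simp only [hzero] at hlim
  exact (tendsto_nhds_unique hlim tendsto_const_nhds)

/-- `L¹` form of the Poincaré–Sobolev inequality. -/
lemma PoincareSobolev.lintegral_oscillation_le (hPS : PoincareSobolev μ f g ρ' CP σ)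
    (hA : IsAhlfors μ c₁ c₂ ν) (hc₁ : 0 < c₁) (hf : AEStronglyMeasurable f μ) (hρ' : 1 < ρ')
    (hσ : 1 ≤ σ) (x : X) {r : ℝ} (hr : 0 < r) :
    ∫⁻ y in ball x r, ‖f y - ⨍ z in ball x r, f z ∂μ‖ₑ ∂μ ≤
      ENNReal.ofReal (CP * r) * ∫⁻ y in ball x (σ * r), g y ∂μ := by
  set c := ⨍ z in ball x r, f z ∂μ with hc
  set m := μ (ball x r)
  set m' := μ (ball x (σ * r))
  have hm0 : m ≠ 0 := (hA.measure_ball_pos hc₁ x hr).ne'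
  have hm : m ≠ ∞ := (hA.measure_ball_lt_top x hr).ne
  have hmm' : m ≤ m' := measure_mono (ball_subset_ball (le_mul_of_one_le_left hr.le hσ))
  have hρ0 : 0 < ρ' := by linarith
  have h1 := lintegral_le_rpow_lintegral_rpow_mul (μ.restrict (ball x r))
    (h := fun y => ‖f y - c‖ₑ) (by fun_prop) hρ'
  have h2 := hPS x r hr
  have h3 : ∀ y, ENNReal.ofReal (|f y - c| ^ ρ') = ‖f y - c‖ₑ ^ ρ' := fun y => by
    rw [Real.enorm_eq_ofReal_abs, ENNReal.ofReal_rpow_of_nonneg (abs_nonneg _) hρ0.le]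
  simp only [← hc, h3] at h2
  rw [Measure.restrict_apply_univ] at h1
  set I := ∫⁻ y in ball x r, ‖f y - c‖ₑ ^ ρ' ∂μ
  calc ∫⁻ y in ball x r, ‖f y - c‖ₑ ∂μ
      ≤ I ^ (1 / ρ') * m ^ (1 - 1 / ρ') := h1
    _ = m * (m⁻¹ * I) ^ (1 / ρ') := by
        rw [ENNReal.mul_rpow_of_nonneg _ _ (by positivity), ENNReal.inv_rpow, ← ENNReal.rpow_neg,
          ← mul_assoc, sub_eq_add_neg, ENNReal.rpow_add _ _ hm0 hm, ENNReal.rpow_one, mul_comm]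
    _ ≤ m * (ENNReal.ofReal (CP * r) * (m'⁻¹ * ∫⁻ y in ball x (σ * r), g y ∂μ)) := by
        gcongr
    _ = (m * m'⁻¹) * (ENNReal.ofReal (CP * r) * ∫⁻ y in ball x (σ * r), g y ∂μ) := by ring
    _ ≤ 1 * (ENNReal.ofReal (CP * r) * ∫⁻ y in ball x (σ * r), g y ∂μ) := by
        gcongr
        rw [← div_eq_mul_inv]; exact ENNReal.div_le_of_le_mul (by rwa [one_mul])
    _ = _ := one_mul _

/-- Contribution of a single dyadic annulus to the truncated singular integral. -/
lemma enorm_setIntegral_annulus_le (hnull : NullCond μ K) (hsize : SizeCond K CK ν)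
    (hA : IsAhlfors μ c₁ c₂ ν) (hc₁ : 0 < c₁) (hν : 0 < ν) (hCK : 0 < CK)
    (hK : Measurable (Function.uncurry K)) (hPS : PoincareSobolev μ f g ρ' CP σ)
    (hf : AEStronglyMeasurable f μ) (hρ' : 1 < ρ') (hσ : 1 ≤ σ) (x : X) {a : ℝ} (ha : 0 < a)
    (hint : IntegrableOn (fun y => K x y * f y) {y | a < dist x y ∧ dist x y ≤ 2 * a} μ) :
    ‖∫ y in {y | a < dist x y ∧ dist x y ≤ 2 * a}, K x y * f y ∂μ‖ₑ ≤
      ENNReal.ofReal (4 * CK * CP * a ^ (1 - ν)) * ∫⁻ y in ball x (4 * σ * a), g y ∂μ := by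
  set A := {y | a < dist x y ∧ dist x y ≤ 2 * a} with hAdef
  set c := ⨍ z in ball x (4 * a), f z ∂μ with hc
  have hKint : IntegrableOn (K x) A μ :=
    (hsize.integrableOn hA hν hCK hK x ha (b := 3 * a)).mono_set
      fun y hy => ⟨hy.1, by linarith [hy.2]⟩
  have hsub : A ⊆ ball x (4 * a) := fun y hy => by rw [mem_ball']; linarith [hy.2]
  have heq : ∫ y in A, K x y * f y ∂μ = ∫ y in A, K x y * (f y - c) ∂μ := by
    have h0 := hnull.integral_annulus hsize hA hν hCK hK x ha (b := 2 * a) (by linarith)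
    simp only [mul_sub]
    rw [integral_sub hint (hKint.mul_const c), integral_mul_const, h0, zero_mul, sub_zero]
  rw [heq]
  calc ‖∫ y in A, K x y * (f y - c) ∂μ‖ₑ
      ≤ ∫⁻ y in A, ‖K x y * (f y - c)‖ₑ ∂μ := enorm_integral_le_lintegral_enorm _
    _ ≤ ∫⁻ y in A, ENNReal.ofReal (CK / a ^ ν) * ‖f y - c‖ₑ ∂μ := by
        refine setLIntegral_mono' (measurableSet_annulus x a (2 * a)) fun y hy => ?_
        rw [enorm_mul]
        gcongr
        exact hsize.enorm_le hν hCK ha hy.1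
    _ = ENNReal.ofReal (CK / a ^ ν) * ∫⁻ y in A, ‖f y - c‖ₑ ∂μ :=
        lintegral_const_mul' _ _ ENNReal.ofReal_ne_top
    _ ≤ ENNReal.ofReal (CK / a ^ ν) * (ENNReal.ofReal (CP * (4 * a)) *
          ∫⁻ y in ball x (σ * (4 * a)), g y ∂μ) := by
        gcongr
        exact (lintegral_mono_set hsub).trans
          (hPS.lintegral_oscillation_le hA hc₁ hf hρ' hσ x (by positivity))
    _ = _ := by
        rw [← mul_assoc, ← ENNReal.ofReal_mul (by positivity), Real.rpow_sub ha, Real.rpow_one,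
          show σ * (4 * a) = 4 * σ * a by ring]
        congr 2
        ring

/-- Morrey control of the mass of a ball. -/
lemma lintegral_ball_le_morreyNorm (hA : IsAhlfors μ c₁ c₂ ν) (hc₁ : 0 < c₁) (hc₂ : 0 < c₂)
    (hg : Measurable g) {p q : ℝ} (hp : 1 < p) (hpq : p ≤ q) (x : X) {r : ℝ} (hr : 0 < r) :
    ∫⁻ y in ball x r, g y ∂μ ≤
      morreyNorm μ p q g * ENNReal.ofReal (c₂ ^ (1 - 1 / q) * r ^ (ν - ν / q)) := by
  set m := μ (ball x r)
  have hm0 : m ≠ 0 := (hA.measure_ball_pos hc₁ x hr).ne'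
  have hm : m ≠ ∞ := (hA.measure_ball_lt_top x hr).ne
  have hp0 : 0 < p := by linarith
  have hq0 : 0 < q := by linarith
  have h1 := lintegral_le_rpow_lintegral_rpow_mul (μ.restrict (ball x r)) hg.aemeasurable hp
  rw [Measure.restrict_apply_univ] at h1
  set I := ∫⁻ y in ball x r, g y ^ p ∂μ
  have h2 : (m ^ (p / q - 1) * I) ^ (1 / p) ≤ morreyNorm μ p q g :=
    le_iSup₂_of_le x r (le_iSup_of_le hr le_rfl)
  have hq1 : 0 ≤ 1 - 1 / q := by
    rw [sub_nonneg, div_le_one hq0]; linarith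
  calc ∫⁻ y in ball x r, g y ∂μ ≤ I ^ (1 / p) * m ^ (1 - 1 / p) := h1
    _ = (m ^ (p / q - 1) * I) ^ (1 / p) * m ^ (1 - 1 / q) := by
        rw [ENNReal.mul_rpow_of_nonneg _ _ (by positivity), ← ENNReal.rpow_mul,
          show 1 - 1 / p = (p / q - 1) * (1 / p) + (1 - 1 / q) by field_simp; ring,
          ENNReal.rpow_add _ _ hm0 hm]
        ring
    _ ≤ morreyNorm μ p q g * ENNReal.ofReal (c₂ * r ^ ν) ^ (1 - 1 / q) := by
        gcongr
        exact (hA x r hr).2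
    _ = _ := by
        rw [ENNReal.ofReal_rpow_of_nonneg (by positivity) hq1,
          Real.mul_rpow hc₂.le (by positivity), ← Real.rpow_mul hr.le]
        congr 4
        ring

end Kernel

/-- Hedberg-type pointwise bound: if the mass of every ball about `x` is controlled both by the
maximal-function growth `l rᵛ` and by the Morrey growth `D r^(ν - ν/q)`, then all truncations at `x`
are bounded by the corresponding geometric mean of `l` and `D`. -/
lemma abs_truncT_le {μ : Measure X} {c₁ c₂ ν CK CP σ ρ' : ℝ} {K : X → X → ℝ} {f : X → ℝ}
    {g : X → ℝ≥0∞} (hnull : NullCond μ K) (hsize : SizeCond K CK ν)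
    (hA : IsAhlfors μ c₁ c₂ ν) (hc₁ : 0 < c₁) (hν : 0 < ν) (hCK : 0 < CK) (hCP : 0 < CP)
    (hK : Measurable (Function.uncurry K)) (hPS : PoincareSobolev μ f g ρ' CP σ)
    (hf : AEStronglyMeasurable f μ) (hρ' : 1 < ρ') (hσ : 1 ≤ σ) {q : ℝ} (hq : 0 < q)
    (hqν : q < ν) {l D : ℝ} (hl : 0 < l) (hD : 0 < D) {x : X}
    (hmax : ∀ r, 0 < r → ∫⁻ y in ball x r, g y ∂μ ≤ ENNReal.ofReal (l * r ^ ν))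
    (hMorrey : ∀ r, 0 < r → ∫⁻ y in ball x r, g y ∂μ ≤ ENNReal.ofReal (D * r ^ (ν - ν / q)))
    {ε : ℝ} (hε : 0 < ε) :
    |truncT μ K f ε x| ≤ 4 * CK * CP * (4 * σ) ^ ν *
      (((1 - (2 : ℝ) ^ (-(ν / q - 1)))⁻¹ + 2) * (l ^ (1 - q / ν) * D ^ (q / ν))) := by
  have hs : 0 < ν / q - 1 := by rw [sub_pos, one_lt_div hq]; exact hqν
  set s := ν / q - 1 with hsdef
  set L := 4 * CK * CP * (4 * σ) ^ ν with hL
  have hL0 : 0 < L := by positivity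
  have hinterp := sum_min_dyadic_interp_le hs hl hD hε
  have hs1 : 1 + s = ν / q := by rw [hsdef]; ring
  have he2 : 1 / (1 + s) = q / ν := by rw [hs1, one_div_div]
  have he1 : s / (1 + s) = 1 - q / ν := by
    rw [← he2, eq_sub_iff_add_eq, ← add_div, add_comm s, div_self (by linarith)]
  rw [he1, he2] at hinterp
  by_cases hint : IntegrableOn (fun y => K x y * f y) {y | ε < dist x y} μ
  swap
  · rw [truncT, integral_undef hint, abs_zero]
    refine le_trans ?_ (mul_le_mul_of_nonneg_left (hinterp 0) hL0.le)
    simp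
  set A : ℕ → Set X := fun k => {y | 2 ^ k * ε < dist x y ∧ dist x y ≤ 2 * (2 ^ k * ε)} with hAdef
  have hpow : ∀ k : ℕ, (2 : ℝ) * (2 ^ k * ε) = 2 ^ (k + 1) * ε := fun k => by ring
  have hmono : Monotone fun k : ℕ => (2 : ℝ) ^ k * ε := fun m n hmn =>
    mul_le_mul_of_nonneg_right (pow_le_pow_right₀ one_le_two hmn) hε.le
  have hdisj : Pairwise (Function.onFun Disjoint A) := by
    refine (pairwise_disjoint_on A).2 fun m n hmn => Set.disjoint_left.2 fun y hm hn => ?_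
    have h1 : (2 : ℝ) * (2 ^ m * ε) ≤ 2 ^ n * ε := by rw [hpow]; exact hmono hmn
    linarith [hm.2, hn.1]
  have hunion : ⋃ k, A k = {y | ε < dist x y} := by
    ext y
    simp only [hAdef, Set.mem_iUnion, Set.mem_ofPred_eq]
    constructor
    · rintro ⟨k, hk, -⟩
      exact lt_of_le_of_lt (by simpa using hmono (Nat.zero_le k)) hk
    · intro hy
      obtain ⟨n, hn, hn'⟩ := exists_mem_Ioc_zpow (x := dist x y / ε) (y := 2)
        (div_pos (hε.trans hy) hε) one_lt_two
      have hn0 : 0 < n + 1 := by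
        rw [← one_lt_zpow_iff_right₀ (one_lt_two (α := ℝ))]
        exact ((one_lt_div hε).2 hy).trans_le hn'
      lift n to ℕ using by omega
      rw [zpow_natCast] at hn
      rw [← Nat.cast_succ, zpow_natCast] at hn'
      refine ⟨n, (lt_div_iff₀ hε).1 hn, ?_⟩
      rw [hpow]
      exact (div_le_iff₀ hε).1 hn'
  have hsum : HasSum (fun k => ∫ y in A k, K x y * f y ∂μ) (truncT μ K f ε x) := by
    have := hasSum_integral_iUnion (μ := μ) (f := fun y => K x y * f y)
      (fun k => measurableSet_annulus x (2 ^ k * ε) (2 * (2 ^ k * ε))) hdisj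
      (by rw [hunion]; exact hint)
    rwa [hunion] at this
  have hterm : ∀ k : ℕ, |∫ y in A k, K x y * f y ∂μ| ≤
      L * min (l * (2 ^ k * ε)) (D * (2 ^ k * ε) ^ (-s)) := by
    intro k
    have ha : (0 : ℝ) < 2 ^ k * ε := by positivity
    have h := enorm_setIntegral_annulus_le hnull hsize hA hc₁ hν hCK hK hPS hf hρ' hσ x ha
      (hint.mono_set (by rw [← hunion]; exact Set.subset_iUnion A k))
    set a : ℝ := 2 ^ k * ε
    have hG1 := hmax (4 * σ * a) (by positivity)
    have hG2 := hMorrey (4 * σ * a) (by positivity)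
    rw [Real.enorm_eq_ofReal_abs] at h
    have ha1 : a ^ (1 - ν) * a ^ ν = a := by rw [← Real.rpow_add ha]; simp
    have ha2 : a ^ (1 - ν) * a ^ (ν - ν / q) = a ^ (-s) := by
      rw [← Real.rpow_add ha, hsdef]; congr 1; ring
    rw [mul_min_of_nonneg _ _ hL0.le]
    refine le_min ?_ ?_
    · rw [← ENNReal.ofReal_le_ofReal_iff (by positivity)]
      refine h.trans ((mul_le_mul_right hG1 _).trans (le_of_eq ?_))
      rw [← ENNReal.ofReal_mul (by positivity), Real.mul_rpow (by positivity) ha.le]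
      congr 1
      calc 4 * CK * CP * a ^ (1 - ν) * (l * ((4 * σ) ^ ν * a ^ ν))
          = L * (l * (a ^ (1 - ν) * a ^ ν)) := by rw [hL]; ring
        _ = _ := by rw [ha1]
    · rw [← ENNReal.ofReal_le_ofReal_iff (by positivity)]
      refine h.trans ((mul_le_mul_right hG2 _).trans ?_)
      rw [← ENNReal.ofReal_mul (by positivity), Real.mul_rpow (by positivity) ha.le]
      refine ENNReal.ofReal_le_ofReal ?_
      have hσν : (4 * σ) ^ (ν - ν / q) ≤ (4 * σ) ^ ν :=
        Real.rpow_le_rpow_of_exponent_le (by linarith) (by linarith [div_pos hν hq])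
      calc 4 * CK * CP * a ^ (1 - ν) * (D * ((4 * σ) ^ (ν - ν / q) * a ^ (ν - ν / q)))
          ≤ 4 * CK * CP * a ^ (1 - ν) * (D * ((4 * σ) ^ ν * a ^ (ν - ν / q))) := by gcongr
        _ = L * (D * (a ^ (1 - ν) * a ^ (ν - ν / q))) := by rw [hL]; ring
        _ = _ := by rw [ha2]
  refine le_of_tendsto hsum.tendsto_sum_nat.abs (Filter.Eventually.of_forall fun n => ?_)
  calc |∑ k ∈ Finset.range n, ∫ y in A k, K x y * f y ∂μ|
      ≤ ∑ k ∈ Finset.range n, |∫ y in A k, K x y * f y ∂μ| := Finset.abs_sum_le_sum_abs _ _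
    _ ≤ ∑ k ∈ Finset.range n, L * min (l * (2 ^ k * ε)) (D * (2 ^ k * ε) ^ (-s)) :=
        Finset.sum_le_sum fun k _ => hterm k
    _ ≤ _ := by
        rw [← Finset.mul_sum]
        exact mul_le_mul_of_nonneg_left (hinterp n) hL0.le

/-- weak-type end-point inequality: with `r = ν/(ν-q)`,
`sup_α α μ({T^*_K f > α})^{1/r} ≤ C ‖g‖_{L^1}^{1-q/ν} ‖g‖_{M^{p,q}}^{q/ν}`. -/
theorem weak_type_endpoint_inequality
    (μ : Measure X) (c₁ c₂ ν CK CP σ ρ' : ℝ) (K : X → X → ℝ) (f : X → ℝ) (g : X → ℝ≥0∞)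
    (hc₁ : 0 < c₁) (hc₁₂ : c₁ ≤ c₂) (hν : 0 < ν) (hA : IsAhlfors μ c₁ c₂ ν)
    (hbal : (2 : ℝ) ^ (1 - ν) * (c₂ / c₁) < 1)
    (hK : Measurable (Function.uncurry K)) (hCK : 0 < CK)
    (hsize : SizeCond K CK ν) (hnull : NullCond μ K)
    (hf : LocallyIntegrable f μ) (hg : LocIntE μ g)
    (hρ'1 : 1 < ρ') (hρ'ν : ρ' < ν) (hCP : 0 < CP) (hσ : 1 ≤ σ)
    (hPS : PoincareSobolev μ f g ρ' CP σ)
    (p q : ℝ) (hp : 1 < p) (hpq : p ≤ q) (hqν : q / ν < 1)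
    (hgM : morreyNorm μ p q g < ∞)
    (hgL1 : ∫⁻ x, g x ∂μ < ∞) :
    ∃ C : ℝ, 0 < C ∧
      (⨆ (α : ℝ) (_ : 0 < α),
          ENNReal.ofReal α *
            μ {x | ENNReal.ofReal α < maxT μ K f x} ^ (1 / (ν / (ν - q))))
        ≤ ENNReal.ofReal C * (∫⁻ x, g x ∂μ) ^ (1 - q / ν) *
            morreyNorm μ p q g ^ (q / ν) := by
  have hq0 : 0 < q := by linarith
  have hqν' : q < ν := (div_lt_one hν).1 hqν
  have hc₂ : 0 < c₂ := hc₁.trans_le hc₁₂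
  have hθ : 0 < 1 - q / ν := by linarith
  have := hA.secondCountableTopology hc₁
  have hfm := hf.aestronglyMeasurable
  set N := ∫⁻ x, g x ∂μ with hN
  set θ := 1 - q / ν with hθdef
  have hr : 1 / (ν / (ν - q)) = θ := by rw [hθdef]; field_simp
  set κ := 4 * CK * CP * (4 * σ) ^ ν * ((1 - (2 : ℝ) ^ (-(ν / q - 1)))⁻¹ + 2) *
    (c₂ ^ (1 - 1 / q)) ^ (q / ν) with hκ
  have hκ0 : 0 < κ := by
    have hs : 0 < ν / q - 1 := by rw [sub_pos, one_lt_div hq0]; exact hqν'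
    have : 0 < (1 - (2 : ℝ) ^ (-(ν / q - 1)))⁻¹ :=
      inv_pos.2 (sub_pos.2 (Real.rpow_lt_one_of_one_lt_of_neg (by norm_num) (by linarith)))
    positivity
  rw [hr]
  refine ⟨(c₂ * 6 ^ ν) ^ θ * κ, by positivity, iSup₂_le fun α hα => ?_⟩
  have key : ∀ M : ℝ, 0 < M → morreyNorm μ p q g ≤ ENNReal.ofReal M →
      ENNReal.ofReal α * μ {x | ENNReal.ofReal α < maxT μ K f x} ^ θ ≤
        ENNReal.ofReal ((c₂ * 6 ^ ν) ^ θ * κ) * N ^ θ * ENNReal.ofReal M ^ (q / ν) := by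
    intro M hM hgM'
    set B := κ * M ^ (q / ν) with hB
    have hB0 : 0 < B := by positivity
    set l := (α / B) ^ (1 / θ) with hl
    have hl0 : 0 < l := by positivity
    have hlθ : l ^ θ = α / B := by
      rw [hl, ← Real.rpow_mul (by positivity), one_div_mul_cancel hθ.ne', Real.rpow_one]
    have hsub : {x | ENNReal.ofReal α < maxT μ K f x} ⊆
        {x | ∃ r, 0 < r ∧ ENNReal.ofReal (l * r ^ ν) < ∫⁻ y in ball x r, g y ∂μ} := by
      intro x hx
      by_contra hcon
      simp only [Set.mem_ofPred_eq, not_exists, not_and, not_lt] at hcon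
      refine not_le.2 hx (iSup₂_le fun ε hε => ENNReal.ofReal_le_ofReal ?_)
      refine (abs_truncT_le hnull hsize hA hc₁ hν hCK hCP hK hPS hfm hρ'1 hσ hq0 hqν' hl0
        (D := M * c₂ ^ (1 - 1 / q)) (by positivity) hcon (fun r hr => ?_) hε).trans (le_of_eq ?_)
      · refine (lintegral_ball_le_morreyNorm hA hc₁ hc₂ hg.1 hp hpq x hr).trans ?_
        rw [mul_assoc, ENNReal.ofReal_mul hM.le]
        gcongr
      · rw [← hθdef, hlθ, Real.mul_rpow hM.le (by positivity)]
        have : B * (α / B) = α := by field_simp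
        refine Eq.trans ?_ this
        generalize α / B = z
        rw [hB, hκ]
        ring
    calc ENNReal.ofReal α * μ {x | ENNReal.ofReal α < maxT μ K f x} ^ θ
        ≤ ENNReal.ofReal α * (ENNReal.ofReal (c₂ * 6 ^ ν / l) * N) ^ θ := by
          gcongr
          exact (measure_mono hsub).trans (hA.measure_large_mass_le hc₁ hν hgL1 hl0)
      _ = _ := by
          rw [ENNReal.mul_rpow_of_nonneg _ _ hθ.le,
            ENNReal.ofReal_rpow_of_nonneg (by positivity) hθ.le,
            ENNReal.ofReal_rpow_of_nonneg hM.le (by positivity), mul_right_comm,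
            ← ENNReal.ofReal_mul (by positivity), ← mul_assoc, ← ENNReal.ofReal_mul hα.le,
            Real.div_rpow (by positivity) hl0.le, hlθ]
          congr 2
          rw [hB]
          field_simp
  have hNθ : N ^ θ ≠ ∞ := ENNReal.rpow_ne_top_of_nonneg hθ.le hgL1.ne
  have hcont : Continuous fun M : ℝ =>
      ENNReal.ofReal ((c₂ * 6 ^ ν) ^ θ * κ) * N ^ θ * ENNReal.ofReal M ^ (q / ν) :=
    (ENNReal.continuous_const_mul (ENNReal.mul_ne_top ENNReal.ofReal_ne_top hNθ)).comp
      (ENNReal.continuous_rpow_const.comp ENNReal.continuous_ofReal)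
  have hlim := hcont.continuousWithinAt (s := Set.Ioi (morreyNorm μ p q g).toReal)
    (x := (morreyNorm μ p q g).toReal)
  have hle := ge_of_tendsto hlim (Filter.eventually_of_mem self_mem_nhdsWithin fun M hM =>
    key M (ENNReal.toReal_nonneg.trans_lt hM) ((ENNReal.le_ofReal_iff_toReal_le hgM.ne
      (ENNReal.toReal_nonneg.trans hM.le)).2 hM.le))
  simpa only [ENNReal.ofReal_toReal hgM.ne] using hle
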